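/- For every inference rule r there exists an inference rule r_nf in reduced normal form, computable from r and of size at most single-exponential in the size of r, such that for every non-transitive linear frame F, r is valid in F if and only if r_nf is valid in F. -/

import Mathlib

/-- LTL formulas: letters, falsum, implication, Next, Until.
Other Boolean connectives are defined as abbreviations. -/
inductive Fml : Type
  | letter : ℕ → Fml
  | bot : Fml
  | imp : Fml → Fml → Fml
  | next : Fml → Fml
  | untl : Fml → Fml → Fml
deriving DecidableEq

namespace Fml
def neg (φ : Fml) : Fml := imp φ bot
def top : Fml := neg bot
def conj (φ ψ : Fml) : Fml := neg (imp φ (neg ψ))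
def disj (φ ψ : Fml) : Fml := imp (neg φ) ψ
/-- □φ abbreviates ¬(⊤ U ¬φ). -/
def box (φ : Fml) : Fml := neg (untl top (neg φ))
end Fml

/-- Truth in a model on the non-transitive linear frame determined by `t : ℕ → ℕ`:
`φ U ψ` at `a` looks only as far as `t a`. -/
def sat (t : ℕ → ℕ) (V : ℕ → Set ℕ) : Fml → ℕ → Prop
  | .letter p, a => a ∈ V p
  | .bot, _ => False
  | .imp φ ψ, a => sat t V φ a → sat t V ψ a
  | .next φ, a => sat t V φ (a + 1)
  | .untl φ ψ, a => ∃ b, a ≤ b ∧ b ≤ t a ∧ sat t V ψ b ∧ ∀ c, a ≤ c → c < b → sat t V φ c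

/-- A non-transitive linear frame: `t i > i` and `t` is increasing on successive points. -/
def NTFrame (t : ℕ → ℕ) : Prop := (∀ i, i < t i) ∧ (∀ i, t i < t (i + 1))

/-- The logic LTL_NT. -/
def LTLNT : Set Fml := {φ | ∀ t, NTFrame t → ∀ V a, sat t V φ a}

/-- Standard LTL semantics on ⟨ℕ, ≤, Next⟩. -/
def satStd (V : ℕ → Set ℕ) : Fml → ℕ → Prop
  | .letter p, a => a ∈ V p
  | .bot, _ => False
  | .imp φ ψ, a => satStd V φ a → satStd V ψ a
  | .next φ, a => satStd V φ (a + 1)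
  | .untl φ ψ, a => ∃ b, a ≤ b ∧ satStd V ψ b ∧ ∀ c, a ≤ c → c < b → satStd V φ c

/-- The standard linear temporal logic LTL. -/
def LTL : Set Fml := {φ | ∀ V a, satStd V φ a}

/-- The logic LTL_NT(m) of uniform intransitivity `m` (frame with `t i = i + m`). -/
def LTLNTm (m : ℕ) : Set Fml := {φ | ∀ V a, sat (· + m) V φ a}

/-- An inference rule: a finite list of premises and a conclusion. -/
structure Rule where
  prem : List Fml
  concl : Fml

/-- A rule is valid in a model iff truth of all premises at all points implies
truth of the conclusion at all points. -/
def validInModel (t : ℕ → ℕ) (V : ℕ → Set ℕ) (r : Rule) : Prop :=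
  (∀ φ ∈ r.prem, ∀ a, sat t V φ a) → ∀ a, sat t V r.concl a

/-- A rule is valid in a frame iff it is valid in every model on it. -/
def validInFrame (t : ℕ → ℕ) (r : Rule) : Prop := ∀ V, validInModel t V r

/-- Size of a formula. -/
def Fml.size : Fml → ℕ
  | .letter _ => 1
  | .bot => 1
  | .imp φ ψ => φ.size + ψ.size + 1
  | .next φ => φ.size + 1
  | .untl φ ψ => φ.size + ψ.size + 1

/-- Size of a rule. -/
def Rule.size (r : Rule) : ℕ := (r.prem.map Fml.size).sum + r.concl.size

/-- An injective encoding of formulas into ℕ (to speak about computability). -/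
def encF : Fml → ℕ
  | .letter p => Nat.pair 0 p
  | .bot => Nat.pair 1 0
  | .imp φ ψ => Nat.pair 2 (Nat.pair (encF φ) (encF ψ))
  | .next φ => Nat.pair 3 (encF φ)
  | .untl φ ψ => Nat.pair 4 (Nat.pair (encF φ) (encF ψ))

def encL : List Fml → ℕ
  | [] => 0
  | φ :: l => Nat.pair (encF φ) (encL l) + 1

/-- An injective encoding of rules into ℕ. -/
def encRule (r : Rule) : ℕ := Nat.pair (encL r.prem) (encF r.concl)

/-- A literal: `φ` or `¬φ` according to a Boolean flag (`α⁰ = α`, `α¹ = ¬α`). -/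
def lit (b : Bool) (φ : Fml) : Fml := if b then φ else φ.neg

/-- Conjunction of a list of formulas. -/
def bigConj : List Fml → Fml
  | [] => Fml.top
  | φ :: l => (bigConj l).conj φ

/-- Disjunction of a list of formulas. -/
def bigDisj : List Fml → Fml
  | [] => Fml.bot
  | φ :: l => (bigDisj l).disj φ

/-- The premise of a rule in reduced normal form: a disjunction over `j < l` of
conjunctions of literals over `xᵢ`, `N xᵢ` (for `i < n`) and `xᵢ U x_k` (for `i ≠ k`). -/
def rnfPremise (n l : ℕ) (t0 t1 : Fin l → Fin n → Bool)
    (t2 : Fin l → Fin n → Fin n → Bool) : Fml :=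
  bigDisj ((List.finRange l).map fun j =>
    bigConj ((List.finRange n).map (fun i => lit (t0 j i) (.letter i)) ++
      (List.finRange n).map (fun i => lit (t1 j i) (.next (.letter i))) ++
      ((List.finRange n).flatMap fun i =>
        ((List.finRange n).filter (fun k => k ≠ i)).map fun k =>
          lit (t2 j i k) (.untl (.letter i) (.letter k))))) 

/-- `IsRNF n l r`: the rule `r` is in reduced normal form with `n` letters and
`l` disjuncts, i.e. of the shape `ε / x₁`. -/
def IsRNF (n l : ℕ) (r : Rule) : Prop :=
  0 < n ∧ 0 < l ∧ r.concl = .letter 0 ∧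
    ∃ t0 t1 t2, r.prem = [rnfPremise n l t0 t1 t2]

/-- Next relation of the finite frame ℱ(N(r)): it wraps the last point `T` to `g`. -/
def wNext (T g : ℕ) (a : ℕ) : ℕ := if a = T then g else a + 1

/-- Truth in a model on the finite frame `ℱ(N(r))` obtained from the frame of `t`:
the base set is `[0, t^[r+1] 0]`, `T = t^[r+1] 0` is the last point, whose `Next` is
`G = t^[g] 0`; `until` from `a` follows `wNext` for at most `t a - a` steps, so on the
last interval it acts as if the interval following it were `[t^[g] 0, t^[g+1] 0]`. -/
def satFin (t : ℕ → ℕ) (T G : ℕ) (V : ℕ → Set ℕ) : Fml → ℕ → Prop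
  | .letter p, a => a ∈ V p
  | .bot, _ => False
  | .imp φ ψ, a => satFin t T G V φ a → satFin t T G V ψ a
  | .next φ, a => satFin t T G V φ (wNext T G a)
  | .untl φ ψ, a => ∃ k, k ≤ t a - a ∧ satFin t T G V ψ ((wNext T G)^[k] a) ∧
      ∀ j < k, satFin t T G V φ ((wNext T G)^[j] a)

/-- `r` is refuted by `V` in the finite frame `ℱ(N(rr))` (with parameter `g`) built
from the frame of `t`: all premises hold at every point of the frame, while the
conclusion fails at some point. -/
def refutedFin (t : ℕ → ℕ) (rr g : ℕ) (V : ℕ → Set ℕ) (r : Rule) : Prop :=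
  (∀ φ ∈ r.prem, ∀ a ≤ t^[rr + 1] 0, satFin t (t^[rr + 1] 0) (t^[g] 0) V φ a) ∧
    ∃ a ≤ t^[rr + 1] 0, ¬ satFin t (t^[rr + 1] 0) (t^[g] 0) V r.concl a

/-- Temporal degree: maximal nesting depth of `N` and `U`. -/
def tdeg : Fml → ℕ
  | .letter _ => 0
  | .bot => 0
  | .imp φ ψ => max (tdeg φ) (tdeg ψ)
  | .next φ => tdeg φ + 1
  | .untl φ ψ => max (tdeg φ) (tdeg ψ) + 1

/-- `i`-fold application of `N`. -/
def nPow : ℕ → Fml → Fml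
  | 0, φ => φ
  | k + 1, φ => .next (nPow k φ)

/-- Substitution of formulas for letters. -/
def subst (σ : ℕ → Fml) : Fml → Fml
  | .letter p => σ p
  | .bot => .bot
  | .imp φ ψ => .imp (subst σ φ) (subst σ ψ)
  | .next φ => .next (subst σ φ)
  | .untl φ ψ => .untl (subst σ φ) (subst σ ψ)

/-- A rule is admissible in a logic `L` iff every substitution making all premises
theorems of `L` makes the conclusion a theorem of `L`. -/
def Admissible (L : Set Fml) (r : Rule) : Prop :=
  ∀ σ : ℕ → Fml, (∀ φ ∈ r.prem, subst σ φ ∈ L) → subst σ r.concl ∈ L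

namespace RNF
open Primrec

/-! ### The construction on codes -/

/-- The `i`-th binary digit of `j`. -/
def bt (j i : ℕ) : Bool := (j / 2 ^ i % 2) == 1

/-- One step of the closure under subformulas, using a table for smaller codes. -/
def subStep (n : ℕ) (T : List (List ℕ)) : List ℕ :=
  n :: (bif n.unpair.1 == 2 then
      T.getD n.unpair.2.unpair.1 [] ++ T.getD n.unpair.2.unpair.2 []
    else bif n.unpair.1 == 3 then T.getD n.unpair.2 []
    else bif n.unpair.1 == 4 then
      Nat.pair 2 n.unpair.2 ::
        (T.getD n.unpair.2.unpair.1 [] ++ T.getD n.unpair.2.unpair.2 [])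
    else [])

def subTbl (n : ℕ) : List (List ℕ) :=
  Nat.rec [] (fun k T => T ++ [subStep k T]) n

/-- Codes of the subformulas of the formula with code `n` (plus `α → β` for every `α U β`). -/
def sub (n : ℕ) : List ℕ := subStep n (subTbl n)

def prems (c : ℕ) : List ℕ := Denumerable.ofNat (List ℕ) c.unpair.1

def nodes (c : ℕ) : List ℕ := sub c.unpair.2 ++ (prems c).flatMap sub

/-- number of letters -/
def mm (c : ℕ) : ℕ := 2 * (nodes c).length + 2

/-- Value of node `k` read off the block of `j` starting at `off`. -/
def vv (c j off k : ℕ) : Bool :=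
  bt j (off + (2 * (nodes c).idxOf k + 2)) || bt j (off + (2 * (nodes c).idxOf k + 3))

def nodeOK (c j k : ℕ) : Bool :=
  bif k.unpair.1 == 1 then !vv c j 0 k
  else bif k.unpair.1 == 2 then
    vv c j 0 k == (!vv c j 0 k.unpair.2.unpair.1 || vv c j 0 k.unpair.2.unpair.2)
  else bif k.unpair.1 == 3 then vv c j 0 k == vv c j (mm c) k.unpair.2
  else bif k.unpair.1 == 4 then
    vv c j 0 k == (vv c j 0 k.unpair.2.unpair.2 ||
      (vv c j 0 k.unpair.2.unpair.1 &&
        (vv c j (3 * mm c) (Nat.pair 2 k.unpair.2) && vv c j (mm c) k)))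
  else true

def allB (f : ℕ → Bool) (l : List ℕ) : Bool := l.foldr (fun x acc => f x && acc) true

def good (c j : ℕ) : Bool :=
  allB (nodeOK c j) (nodes c) && (allB (vv c j 0) (prems c) &&
    ((!vv c j 0 c.unpair.2 || bt j 0) && bt j 1))

def T0 (c j i : ℕ) : Bool := good c j && bt j i
def T1 (c j i : ℕ) : Bool := bt j (mm c + i)
def T2 (c j i k : ℕ) : Bool :=
  !good c j || (bif decide (i < 2) then bt j ((2 + i) * mm c + k)
    else (bt j k || (bt j i && bt j (mm c + k))))

def ll (c : ℕ) : ℕ := 2 ^ (4 * mm c)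

def nf (r : Rule) : Rule :=
  ⟨[rnfPremise (mm (encRule r)) (ll (encRule r)) (fun j i => T0 (encRule r) j i)
    (fun j i => T1 (encRule r) j i) (fun j i k => T2 (encRule r) j i k)], .letter 0⟩

/-! ### Computability -/

def negC (x : ℕ) : ℕ := Nat.pair 2 (Nat.pair x (Nat.pair 1 0))
def conjC (x y : ℕ) : ℕ := negC (Nat.pair 2 (Nat.pair x (negC y)))
def disjC (x y : ℕ) : ℕ := Nat.pair 2 (Nat.pair (negC x) y)
def litC (b : Bool) (x : ℕ) : ℕ := bif b then x else negC x
def bigConjC (l : List ℕ) : ℕ := l.foldr (fun x acc => conjC acc x) (negC (Nat.pair 1 0))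
def bigDisjC (l : List ℕ) : ℕ := l.foldr (fun x acc => disjC acc x) (Nat.pair 1 0)

def disjunctC (c j : ℕ) : ℕ :=
  bigConjC ((List.range (mm c)).map (fun i => litC (T0 c j i) (Nat.pair 0 i)) ++
    (List.range (mm c)).map (fun i => litC (T1 c j i) (Nat.pair 3 (Nat.pair 0 i))) ++
    (List.range (mm c)).flatMap fun i => (List.range (mm c)).flatMap fun k =>
      bif k == i then [] else
        [litC (T2 c j i k) (Nat.pair 4 (Nat.pair (Nat.pair 0 i) (Nat.pair 0 k)))])

def FF (c : ℕ) : ℕ :=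
  Nat.pair (Nat.pair (bigDisjC ((List.range (ll c)).map (disjunctC c))) 0 + 1) (Nat.pair 0 0)

section comp
variable {α : Type} [Primcodable α]

theorem pow_pr {f g : α → ℕ} (hf : Primrec f) (hg : Primrec g) :
    Primrec fun a => f a ^ g a :=
  (Primrec₂.unpaired'.1 Nat.Primrec.pow).comp hf hg

theorem add_pr {f g : α → ℕ} (hf : Primrec f) (hg : Primrec g) :
    Primrec fun a => f a + g a := Primrec.nat_add.comp hf hg
theorem mul_pr {f g : α → ℕ} (hf : Primrec f) (hg : Primrec g) :
    Primrec fun a => f a * g a := Primrec.nat_mul.comp hf hg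
theorem pair_pr {f g : α → ℕ} (hf : Primrec f) (hg : Primrec g) :
    Primrec fun a => Nat.pair (f a) (g a) := Primrec₂.natPair.comp hf hg
theorem u1_pr {f : α → ℕ} (hf : Primrec f) :
    Primrec fun a => (f a).unpair.1 := Primrec.fst.comp (Primrec.unpair.comp hf)
theorem u2_pr {f : α → ℕ} (hf : Primrec f) :
    Primrec fun a => (f a).unpair.2 := Primrec.snd.comp (Primrec.unpair.comp hf)
theorem beq_pr {f g : α → ℕ} (hf : Primrec f) (hg : Primrec g) :
    Primrec fun a => (f a == g a) := Primrec.beq.comp hf hg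
theorem beqB_pr {f g : α → Bool} (hf : Primrec f) (hg : Primrec g) :
    Primrec fun a => (f a == g a) := Primrec.beq.comp hf hg
theorem and_pr {f g : α → Bool} (hf : Primrec f) (hg : Primrec g) :
    Primrec fun a => (f a && g a) := Primrec.and.comp hf hg
theorem or_pr {f g : α → Bool} (hf : Primrec f) (hg : Primrec g) :
    Primrec fun a => (f a || g a) := Primrec.or.comp hf hg
theorem not_pr {f : α → Bool} (hf : Primrec f) :
    Primrec fun a => (!f a) := Primrec.not.comp hf
theorem lt_pr {f g : α → ℕ} (hf : Primrec f) (hg : Primrec g) :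
    Primrec fun a => decide (f a < g a) := Primrec.nat_lt.decide.comp hf hg
theorem app_pr {f g : α → List ℕ} (hf : Primrec f) (hg : Primrec g) :
    Primrec fun a => f a ++ g a := Primrec.list_append.comp hf hg
theorem cons_pr {f : α → ℕ} {g : α → List ℕ} (hf : Primrec f) (hg : Primrec g) :
    Primrec fun a => f a :: g a := Primrec.list_cons.comp hf hg

theorem bt_pr {f g : α → ℕ} (hf : Primrec f) (hg : Primrec g) :
    Primrec fun a => bt (f a) (g a) :=
  beq_pr (Primrec.nat_mod.comp (Primrec.nat_div.comp hf (pow_pr (Primrec.const 2) hg))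
    (Primrec.const 2)) (Primrec.const 1)

theorem getD_pr {f : α → List (List ℕ)} {g : α → ℕ} (hf : Primrec f) (hg : Primrec g) :
    Primrec fun a => (f a).getD (g a) [] := (Primrec.list_getD []).comp hf hg

theorem subStep_pr {f : α → ℕ} {g : α → List (List ℕ)} (hf : Primrec f) (hg : Primrec g) :
    Primrec fun a => subStep (f a) (g a) := by
  have h1 := u1_pr hf
  have h2 := u2_pr hf
  have ha := getD_pr hg (u1_pr h2)
  have hb := getD_pr hg (u2_pr h2)
  exact cons_pr hf (Primrec.cond (beq_pr h1 (Primrec.const 2)) (app_pr ha hb)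
    (Primrec.cond (beq_pr h1 (Primrec.const 3)) (getD_pr hg h2)
      (Primrec.cond (beq_pr h1 (Primrec.const 4))
        (cons_pr (pair_pr (Primrec.const 2) h2) (app_pr ha hb)) (Primrec.const []))))

theorem subTbl_pr : Primrec subTbl := by
  refine Primrec.nat_rec₁ (f := fun k T => T ++ [subStep k T]) [] ?_
  refine Primrec.list_append.comp Primrec.snd ?_
  exact Primrec.list_cons.comp (subStep_pr Primrec.fst Primrec.snd) (Primrec.const [])

theorem sub_pr : Primrec sub := subStep_pr Primrec.id subTbl_pr

theorem prems_pr : Primrec prems := (Primrec.ofNat (List ℕ)).comp (u1_pr Primrec.id)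

theorem nodes_pr : Primrec nodes :=
  app_pr (sub_pr.comp (u2_pr Primrec.id))
    (Primrec.list_flatMap prems_pr (sub_pr.comp Primrec.snd).to₂)

theorem mm_pr : Primrec mm :=
  add_pr (mul_pr (Primrec.const 2) (Primrec.list_length.comp nodes_pr)) (Primrec.const 2)

theorem vv_pr {c j o k : α → ℕ} (hc : Primrec c) (hj : Primrec j) (ho : Primrec o)
    (hk : Primrec k) : Primrec fun a => vv (c a) (j a) (o a) (k a) := by
  have h : Primrec fun a => 2 * (nodes (c a)).idxOf (k a) :=
    mul_pr (Primrec.const 2) (Primrec.list_idxOf.comp hk (nodes_pr.comp hc) )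
  exact or_pr (bt_pr hj (add_pr ho (add_pr h (Primrec.const 2))))
    (bt_pr hj (add_pr ho (add_pr h (Primrec.const 3))))

theorem nodeOK_pr {c j k : α → ℕ} (hc : Primrec c) (hj : Primrec j)
    (hk : Primrec k) : Primrec fun a => nodeOK (c a) (j a) (k a) := by
  have h1 := u1_pr hk
  have h2 := u2_pr hk
  have ha := u1_pr h2
  have hb := u2_pr h2
  have hm := mm_pr.comp hc
  have h0 : Primrec fun _ : α => 0 := Primrec.const 0
  have hv := vv_pr hc hj h0 hk
  exact Primrec.cond (beq_pr h1 (Primrec.const 1)) (not_pr hv)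
    (Primrec.cond (beq_pr h1 (Primrec.const 2))
      (beqB_pr hv (or_pr (not_pr (vv_pr hc hj h0 ha)) (vv_pr hc hj h0 hb)))
    (Primrec.cond (beq_pr h1 (Primrec.const 3)) (beqB_pr hv (vv_pr hc hj hm h2))
    (Primrec.cond (beq_pr h1 (Primrec.const 4))
      (beqB_pr hv (or_pr (vv_pr hc hj h0 hb) (and_pr (vv_pr hc hj h0 ha)
        (and_pr (vv_pr hc hj (mul_pr (Primrec.const 3) hm) (pair_pr (Primrec.const 2) h2))
          (vv_pr hc hj hm hk)))))
      (Primrec.const true))))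

theorem allB_pr {f : α → ℕ → Bool} {g : α → List ℕ} (hf : Primrec₂ f) (hg : Primrec g) :
    Primrec fun a => allB (f a) (g a) :=
  Primrec.list_foldr (h := fun a p => f a p.1 && p.2) hg (Primrec.const true)
    (and_pr (hf.comp Primrec.fst (Primrec.fst.comp Primrec.snd))
      (Primrec.snd.comp Primrec.snd)).to₂

theorem good_pr {c j : α → ℕ} (hc : Primrec c) (hj : Primrec j) :
    Primrec fun a => good (c a) (j a) := by
  have hc' : Primrec fun p : α × ℕ => c p.1 := hc.comp Primrec.fst
  have hj' : Primrec fun p : α × ℕ => j p.1 := hj.comp Primrec.fst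
  exact and_pr (allB_pr (nodeOK_pr hc' hj' Primrec.snd).to₂ (nodes_pr.comp hc))
    (and_pr (allB_pr (vv_pr hc' hj' (Primrec.const 0) Primrec.snd).to₂ (prems_pr.comp hc))
      (and_pr (or_pr (not_pr (vv_pr hc hj (Primrec.const 0) (u2_pr hc)))
        (bt_pr hj (Primrec.const 0))) (bt_pr hj (Primrec.const 1))))

theorem T0_pr {c j i : α → ℕ} (hc : Primrec c) (hj : Primrec j) (hi : Primrec i) :
    Primrec fun a => T0 (c a) (j a) (i a) := and_pr (good_pr hc hj) (bt_pr hj hi)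
theorem T1_pr {c j i : α → ℕ} (hc : Primrec c) (hj : Primrec j) (hi : Primrec i) :
    Primrec fun a => T1 (c a) (j a) (i a) := bt_pr hj (add_pr (mm_pr.comp hc) hi)
theorem T2_pr {c j i k : α → ℕ} (hc : Primrec c) (hj : Primrec j) (hi : Primrec i)
    (hk : Primrec k) : Primrec fun a => T2 (c a) (j a) (i a) (k a) :=
  or_pr (not_pr (good_pr hc hj)) (Primrec.cond (lt_pr hi (Primrec.const 2))
    (bt_pr hj (add_pr (mul_pr (add_pr (Primrec.const 2) hi) (mm_pr.comp hc)) hk))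
    (or_pr (bt_pr hj hk) (and_pr (bt_pr hj hi) (bt_pr hj (add_pr (mm_pr.comp hc) hk)))))

theorem ll_pr : Primrec ll := pow_pr (Primrec.const 2) (mul_pr (Primrec.const 4) mm_pr)

theorem negC_pr {f : α → ℕ} (hf : Primrec f) : Primrec fun a => negC (f a) :=
  pair_pr (Primrec.const 2) (pair_pr hf (Primrec.const _))
theorem conjC_pr {f g : α → ℕ} (hf : Primrec f) (hg : Primrec g) :
    Primrec fun a => conjC (f a) (g a) :=
  negC_pr (pair_pr (Primrec.const 2) (pair_pr hf (negC_pr hg)))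
theorem disjC_pr {f g : α → ℕ} (hf : Primrec f) (hg : Primrec g) :
    Primrec fun a => disjC (f a) (g a) :=
  pair_pr (Primrec.const 2) (pair_pr (negC_pr hf) hg)
theorem litC_pr {b : α → Bool} {f : α → ℕ} (hb : Primrec b) (hf : Primrec f) :
    Primrec fun a => litC (b a) (f a) := Primrec.cond hb hf (negC_pr hf)
theorem bigConjC_pr : Primrec bigConjC :=
  Primrec.list_foldr (h := fun _ p => conjC p.2 p.1) Primrec.id (Primrec.const _)
    (conjC_pr (Primrec.snd.comp Primrec.snd) (Primrec.fst.comp Primrec.snd)).to₂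
theorem bigDisjC_pr : Primrec bigDisjC :=
  Primrec.list_foldr (h := fun _ p => disjC p.2 p.1) Primrec.id (Primrec.const _)
    (disjC_pr (Primrec.snd.comp Primrec.snd) (Primrec.fst.comp Primrec.snd)).to₂

theorem disjunctC_pr : Primrec₂ disjunctC := by
  have hr : Primrec fun p : ℕ × ℕ => List.range (mm p.1) :=
    Primrec.list_range.comp (mm_pr.comp Primrec.fst)
  have c1 : Primrec fun p : (ℕ × ℕ) × ℕ => p.1.1 := Primrec.fst.comp Primrec.fst
  have j1 : Primrec fun p : (ℕ × ℕ) × ℕ => p.1.2 := Primrec.snd.comp Primrec.fst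
  have c2 : Primrec fun p : ((ℕ × ℕ) × ℕ) × ℕ => p.1.1.1 := c1.comp Primrec.fst
  have j2 : Primrec fun p : ((ℕ × ℕ) × ℕ) × ℕ => p.1.1.2 := j1.comp Primrec.fst
  have i2 : Primrec fun p : ((ℕ × ℕ) × ℕ) × ℕ => p.1.2 := Primrec.snd.comp Primrec.fst
  have k2 : Primrec fun p : ((ℕ × ℕ) × ℕ) × ℕ => p.2 := Primrec.snd
  refine bigConjC_pr.comp (app_pr (app_pr ?_ ?_) ?_)
  · exact Primrec.list_map hr
      (litC_pr (T0_pr c1 j1 Primrec.snd) (pair_pr (Primrec.const 0) Primrec.snd)).to₂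
  · exact Primrec.list_map hr
      (litC_pr (T1_pr c1 j1 Primrec.snd)
        (pair_pr (Primrec.const 3) (pair_pr (Primrec.const 0) Primrec.snd))).to₂
  · have e : Primrec fun p : ((ℕ × ℕ) × ℕ) × ℕ => litC (T2 p.1.1.1 p.1.1.2 p.1.2 p.2)
        (Nat.pair 4 (Nat.pair (Nat.pair 0 p.1.2) (Nat.pair 0 p.2))) :=
      litC_pr (T2_pr c2 j2 i2 k2) (pair_pr (Primrec.const 4)
        (pair_pr (pair_pr (Primrec.const 0) i2) (pair_pr (Primrec.const 0) k2)))
    have e1 := cons_pr e (Primrec.const [])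
    have e2 : Primrec fun p : ((ℕ × ℕ) × ℕ) × ℕ => p.2 == p.1.2 := beq_pr k2 i2
    have e3 : Primrec₂ fun (p : (ℕ × ℕ) × ℕ) (k : ℕ) => bif k == p.2 then [] else
        [litC (T2 p.1.1 p.1.2 p.2 k)
          (Nat.pair 4 (Nat.pair (Nat.pair 0 p.2) (Nat.pair 0 k)))] :=
      Primrec.cond e2 (Primrec.const []) e1
    have hr1 : Primrec fun p : (ℕ × ℕ) × ℕ => List.range (mm p.1.1) := hr.comp Primrec.fst
    have e4 : Primrec₂ fun (p : ℕ × ℕ) (i : ℕ) => (List.range (mm p.1)).flatMap fun k =>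
        bif k == i then [] else
        [litC (T2 p.1 p.2 i k)
          (Nat.pair 4 (Nat.pair (Nat.pair 0 i) (Nat.pair 0 k)))] :=
      Primrec.list_flatMap hr1 e3
    exact Primrec.list_flatMap hr e4

theorem bigC_pr : Primrec fun c => bigDisjC ((List.range (ll c)).map (disjunctC c)) :=
  bigDisjC_pr.comp (Primrec.list_map (Primrec.list_range.comp ll_pr) disjunctC_pr)

theorem FF_pr : Primrec FF := by
  have h1 : Primrec fun c : ℕ =>
      Nat.pair (bigDisjC ((List.range (ll c)).map (disjunctC c))) 0 :=
    pair_pr bigC_pr (Primrec.const 0)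
  exact pair_pr (Primrec.succ.comp h1) (Primrec.const (Nat.pair 0 0))
end comp

theorem encF_bigConj (l : List Fml) : encF (bigConj l) = bigConjC (l.map encF) := by
  induction l with
  | nil => rfl
  | cons a l ih =>
    simp only [bigConj, List.map_cons, bigConjC, List.foldr_cons] at ih ⊢
    rw [← ih]; rfl

theorem encF_bigDisj (l : List Fml) : encF (bigDisj l) = bigDisjC (l.map encF) := by
  induction l with
  | nil => rfl
  | cons a l ih =>
    simp only [bigDisj, List.map_cons, bigDisjC, List.foldr_cons] at ih ⊢
    rw [← ih]; rfl

theorem encF_lit (b : Bool) (φ : Fml) : encF (lit b φ) = litC b (encF φ) := by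
  cases b <;> rfl

theorem map_finRange {β : Type} (n : ℕ) (f : ℕ → β) :
    (List.finRange n).map (fun i : Fin n => f i) = (List.range n).map f := by
  apply List.ext_getElem
  · simp
  · intro i h1 h2
    rw [List.getElem_map, List.getElem_map, List.getElem_finRange, List.getElem_range]
    simp

theorem flatMap_finRange {β : Type} (n : ℕ) (f : ℕ → List β) :
    (List.finRange n).flatMap (fun i : Fin n => f i) = (List.range n).flatMap f := by
  rw [List.flatMap_def, List.flatMap_def, map_finRange]

theorem filter_map_eq {β γ : Type} (l : List β) (p : β → Bool) (f : β → γ) :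
    (l.filter p).map f = l.flatMap (fun k => bif p k then [f k] else []) := by
  induction l with
  | nil => rfl
  | cons a l ih => cases h : p a <;> simp [h, ih]

theorem encF_rnf (n l : ℕ) (S0 S1 : ℕ → ℕ → Bool) (S2 : ℕ → ℕ → ℕ → Bool) :
    encF (rnfPremise n l (fun j i => S0 j i) (fun j i => S1 j i) (fun j i k => S2 j i k)) =
      bigDisjC ((List.range l).map fun j =>
  bigConjC ((List.range n).map (fun i => litC (S0 j i) (Nat.pair 0 i)) ++
    (List.range n).map (fun i => litC (S1 j i) (Nat.pair 3 (Nat.pair 0 i))) ++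
    (List.range n).flatMap fun i => (List.range n).flatMap fun k =>
      bif k == i then [] else
        [litC (S2 j i k) (Nat.pair 4 (Nat.pair (Nat.pair 0 i) (Nat.pair 0 k)))])) := by
  rw [rnfPremise, encF_bigDisj, List.map_map, ← map_finRange]
  congr 1
  refine List.map_congr_left fun j _ => ?_
  rw [Function.comp, encF_bigConj, List.map_append, List.map_append, List.map_map,
    List.map_map, List.map_flatMap, ← map_finRange, ← map_finRange, ← flatMap_finRange]
  congr 2
  · congr 1
    · exact List.map_congr_left fun i _ => encF_lit _ _
    · exact List.map_congr_left fun i _ => encF_lit _ _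
  · congr 1
    funext i
    rw [filter_map_eq, ← flatMap_finRange, List.map_flatMap]
    congr 1
    funext k
    by_cases h : k = i
    · simp [h]
    · have : (k : ℕ) ≠ i := fun h' => h (Fin.ext h')
      have hb : ((k : ℕ) == (i : ℕ)) = false := beq_false_of_ne this
      rw [hb]
      simp [h, encF_lit, encF]

theorem FF_spec (r : Rule) : FF (encRule r) = encRule (nf r) := by
  have h := encF_rnf (mm (encRule r)) (ll (encRule r)) (T0 (encRule r)) (T1 (encRule r))
    (T2 (encRule r))
  have h' : encRule (nf r) = Nat.pair (Nat.pair (encF (rnfPremise (mm (encRule r))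
    (ll (encRule r)) (fun j i => T0 (encRule r) j i)
    (fun j i => T1 (encRule r) j i) (fun j i k => T2 (encRule r) j i k))) 0 + 1)
    (Nat.pair 0 0) := by simp only [nf, encRule, encL, encF]
  rw [h', h]
  delta FF disjunctC
  with_reducible rfl

/-! ### Subformula lists -/

theorem subTbl_length (n : ℕ) : (subTbl n).length = n := by
  induction n with
  | zero => rfl
  | succ n ih =>
    show (subTbl n ++ [subStep n (subTbl n)]).length = n + 1
    simp [ih]

theorem subTbl_getD (n a : ℕ) (h : a < n) : (subTbl n).getD a [] = sub a := by
  induction n with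
  | zero => omega
  | succ n ih =>
    show (subTbl n ++ [subStep n (subTbl n)]).getD a [] = sub a
    rcases Nat.lt_succ_iff_lt_or_eq.1 h with h1 | h1
    · rw [List.getD_append _ _ _ _ (by rw [subTbl_length]; exact h1), ih h1]
    · subst h1
      rw [List.getD_append_right _ _ _ _ (by rw [subTbl_length]), subTbl_length]
      simp [sub]

theorem lt_pair_l (s a b : ℕ) (hs : 0 < s) : a < Nat.pair s (Nat.pair a b) := by
  have := Nat.add_le_pair s (Nat.pair a b)
  have := Nat.add_le_pair a b
  omega
theorem lt_pair_r (s a b : ℕ) (hs : 0 < s) : b < Nat.pair s (Nat.pair a b) := by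
  have := Nat.add_le_pair s (Nat.pair a b)
  have := Nat.add_le_pair a b
  omega
theorem lt_pair_1 (s a : ℕ) (hs : 0 < s) : a < Nat.pair s a := by
  have := Nat.add_le_pair s a
  omega

theorem sub_imp (a b : ℕ) : sub (Nat.pair 2 (Nat.pair a b)) =
    Nat.pair 2 (Nat.pair a b) :: (sub a ++ sub b) := by
  rw [sub, subStep]
  simp only [Nat.unpair_pair]
  rw [subTbl_getD _ _ (lt_pair_l 2 a b (by omega)), subTbl_getD _ _ (lt_pair_r 2 a b (by omega))]
  rfl

theorem sub_untl (a b : ℕ) : sub (Nat.pair 4 (Nat.pair a b)) =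
    Nat.pair 4 (Nat.pair a b) :: Nat.pair 2 (Nat.pair a b) :: (sub a ++ sub b) := by
  rw [sub, subStep]
  simp only [Nat.unpair_pair]
  rw [subTbl_getD _ _ (lt_pair_l 4 a b (by omega)), subTbl_getD _ _ (lt_pair_r 4 a b (by omega))]
  rfl

theorem sub_next (a : ℕ) : sub (Nat.pair 3 a) = Nat.pair 3 a :: sub a := by
  rw [sub, subStep]
  simp only [Nat.unpair_pair]
  rw [subTbl_getD _ a (lt_pair_1 3 a (by omega))]
  rfl

theorem sub_letter (p : ℕ) : sub (Nat.pair 0 p) = [Nat.pair 0 p] := by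
  rw [sub, subStep]
  simp only [Nat.unpair_pair]
  rfl

theorem sub_bot : sub (Nat.pair 1 0) = [Nat.pair 1 0] := by
  rw [sub, subStep]
  simp only [Nat.unpair_pair]
  rfl

theorem mem_sub_self (n : ℕ) : n ∈ sub n := by
  rw [sub, subStep]; exact List.mem_cons_self

theorem sub_length (φ : Fml) : (sub (encF φ)).length ≤ 2 * φ.size := by
  induction φ with
  | letter p => simp [encF, sub_letter, Fml.size]
  | bot => rw [encF, sub_bot]; simp [Fml.size]
  | imp a b iha ihb => rw [encF, sub_imp]; simp [Fml.size]; omega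
  | next a iha => rw [encF, sub_next]; simp [Fml.size]; omega
  | untl a b iha ihb => rw [encF, sub_untl]; simp [Fml.size]; omega

theorem sub_closed (φ : Fml) : ∀ k ∈ sub (encF φ), ∃ ψ, encF ψ = k ∧ sub k ⊆ sub (encF φ) := by
  induction φ with
  | letter p =>
    intro k hk
    rw [encF, sub_letter, List.mem_singleton] at hk
    exact ⟨.letter p, hk.symm, by rw [hk]; exact List.Subset.refl _⟩
  | bot =>
    intro k hk
    rw [encF, sub_bot, List.mem_singleton] at hk
    exact ⟨.bot, hk.symm, by rw [hk]; exact List.Subset.refl _⟩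
  | imp a b iha ihb =>
    intro k hk
    have e := sub_imp (encF a) (encF b)
    rw [encF, e, List.mem_cons, List.mem_append] at hk
    rcases hk with hk | hk | hk
    · exact ⟨.imp a b, hk.symm, by rw [hk]; exact List.Subset.refl _⟩
    · obtain ⟨ψ, h1, h2⟩ := iha k hk
      refine ⟨ψ, h1, fun x hx => ?_⟩
      rw [encF, e]; simp [h2 hx]
    · obtain ⟨ψ, h1, h2⟩ := ihb k hk
      refine ⟨ψ, h1, fun x hx => ?_⟩
      rw [encF, e]; simp [h2 hx]
  | next a iha =>
    intro k hk
    have e := sub_next (encF a)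
    rw [encF, e, List.mem_cons] at hk
    rcases hk with hk | hk
    · exact ⟨.next a, hk.symm, by rw [hk]; exact List.Subset.refl _⟩
    · obtain ⟨ψ, h1, h2⟩ := iha k hk
      refine ⟨ψ, h1, fun x hx => ?_⟩
      rw [encF, e]; simp [h2 hx]
  | untl a b iha ihb =>
    intro k hk
    have e := sub_untl (encF a) (encF b)
    rw [encF, e, List.mem_cons, List.mem_cons, List.mem_append] at hk
    rcases hk with hk | hk | hk | hk
    · exact ⟨.untl a b, hk.symm, by rw [hk]; exact List.Subset.refl _⟩
    · refine ⟨.imp a b, hk.symm, fun x hx => ?_⟩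
      rw [hk, sub_imp] at hx
      rw [encF, e]
      exact List.mem_cons_of_mem _ hx
    · obtain ⟨ψ, h1, h2⟩ := iha k hk
      refine ⟨ψ, h1, fun x hx => ?_⟩
      rw [encF, e]; simp [h2 hx]
    · obtain ⟨ψ, h1, h2⟩ := ihb k hk
      refine ⟨ψ, h1, fun x hx => ?_⟩
      rw [encF, e]; simp [h2 hx]

theorem encL_eq (l : List Fml) : encL l = Encodable.encode (l.map encF) := by
  induction l with
  | nil => rfl
  | cons a l ih => rw [encL, ih, List.map_cons, Encodable.encode_list_cons]; rfl

theorem prems_enc (r : Rule) : prems (encRule r) = r.prem.map encF := by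
  rw [prems, encRule, Nat.unpair_pair, encL_eq, Denumerable.ofNat_encode]

theorem concl_enc (r : Rule) : (encRule r).unpair.2 = encF r.concl := by
  rw [encRule, Nat.unpair_pair]

theorem nodes_enc (r : Rule) : nodes (encRule r) =
    sub (encF r.concl) ++ (r.prem.map encF).flatMap sub := by
  rw [nodes, prems_enc, concl_enc]

theorem nodes_closed (r : Rule) (k : ℕ) (hk : k ∈ nodes (encRule r)) :
    ∃ ψ, encF ψ = k ∧ sub k ⊆ nodes (encRule r) := by
  rw [nodes_enc] at hk ⊢
  rcases List.mem_append.1 hk with hk | hk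
  · obtain ⟨ψ, h1, h2⟩ := sub_closed _ _ hk
    exact ⟨ψ, h1, fun x hx => List.mem_append_left _ (h2 hx)⟩
  · obtain ⟨x, hx, hk⟩ := List.mem_flatMap.1 hk
    obtain ⟨φ, hφ, rfl⟩ := List.mem_map.1 hx
    obtain ⟨ψ, h1, h2⟩ := sub_closed _ _ hk
    exact ⟨ψ, h1, fun y hy => List.mem_append_right _ (List.mem_flatMap.2 ⟨_, hx, h2 hy⟩)⟩

theorem concl_sub (r : Rule) : sub (encF r.concl) ⊆ nodes (encRule r) := by
  rw [nodes_enc]; exact List.subset_append_left _ _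

theorem prem_sub (r : Rule) (φ : Fml) (h : φ ∈ r.prem) :
    sub (encF φ) ⊆ nodes (encRule r) := by
  rw [nodes_enc]
  exact fun y hy => List.mem_append_right _
    (List.mem_flatMap.2 ⟨_, List.mem_map.2 ⟨φ, h, rfl⟩, hy⟩)

theorem encF_inj : ∀ φ ψ : Fml, encF φ = encF ψ → φ = ψ := by
  intro φ
  induction φ with
  | letter p => intro ψ h; cases ψ <;> simp_all [encF, Nat.pair_eq_pair]
  | bot => intro ψ h; cases ψ <;> simp_all [encF, Nat.pair_eq_pair]
  | imp a b iha ihb =>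
    intro ψ h
    cases ψ <;> simp only [encF, Nat.pair_eq_pair] at h <;> try omega
    rw [iha _ h.2.1, ihb _ h.2.2]
  | next a iha =>
    intro ψ h
    cases ψ <;> simp only [encF, Nat.pair_eq_pair] at h <;> try omega
    rw [iha _ h.2]
  | untl a b iha ihb =>
    intro ψ h
    cases ψ <;> simp only [encF, Nat.pair_eq_pair] at h <;> try omega
    rw [iha _ h.2.1, ihb _ h.2.2]

/-! ### Size -/

theorem mm_le (r : Rule) : mm (encRule r) ≤ 4 * r.size + 2 := by
  have : ∀ l : List Fml, ((l.map encF).flatMap sub).length ≤ 2 * (l.map Fml.size).sum := by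
    intro l
    induction l with
    | nil => simp
    | cons a l ih =>
      have := sub_length a
      simp only [List.map_cons, List.flatMap_cons, List.length_append, List.sum_cons]
      omega
  have h1 := this r.prem
  have h2 := sub_length r.concl
  rw [mm, nodes_enc, List.length_append, Rule.size]
  omega

theorem bigConj_size (l : List Fml) (B : ℕ) (h : ∀ φ ∈ l, φ.size ≤ B) :
    (bigConj l).size ≤ 3 + l.length * (B + 5) := by
  induction l with
  | nil => simp [bigConj, Fml.top, Fml.neg, Fml.size]
  | cons a l ih =>
    have h1 := ih fun φ hφ => h φ (List.mem_cons_of_mem _ hφ)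
    have h2 := h a List.mem_cons_self
    simp only [bigConj, Fml.conj, Fml.neg, Fml.size, List.length_cons, Nat.succ_mul]
    omega

theorem bigDisj_size (l : List Fml) (B : ℕ) (h : ∀ φ ∈ l, φ.size ≤ B) :
    (bigDisj l).size ≤ 1 + l.length * (B + 3) := by
  induction l with
  | nil => simp [bigDisj, Fml.size]
  | cons a l ih =>
    have h1 := ih fun φ hφ => h φ (List.mem_cons_of_mem _ hφ)
    have h2 := h a List.mem_cons_self
    simp only [bigDisj, Fml.disj, Fml.neg, Fml.size, List.length_cons, Nat.succ_mul]
    omega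

theorem lit_size (b : Bool) (φ : Fml) : (lit b φ).size ≤ φ.size + 2 := by
  cases b <;> simp [lit, Fml.neg, Fml.size]

theorem flatMap_length_le {β γ : Type} (l : List β) (f : β → List γ) (B : ℕ)
    (h : ∀ x ∈ l, (f x).length ≤ B) : (l.flatMap f).length ≤ l.length * B := by
  induction l with
  | nil => simp
  | cons a l ih =>
    have h1 := ih fun φ hφ => h φ (List.mem_cons_of_mem _ hφ)
    have h2 := h a List.mem_cons_self
    simp only [List.flatMap_cons, List.length_append, List.length_cons, Nat.succ_mul]
    omega

theorem rnf_size (n l : ℕ) (t0 t1 : Fin l → Fin n → Bool) (t2 : Fin l → Fin n → Fin n → Bool) :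
    (rnfPremise n l t0 t1 t2).size ≤ 1 + l * ((3 + (n + n + n * n) * 10) + 3) := by
  rw [rnfPremise]
  refine (bigDisj_size _ (3 + (n + n + n * n) * 10) ?_).trans ?_
  · intro φ hφ
    obtain ⟨j, -, rfl⟩ := List.mem_map.1 hφ
    refine (bigConj_size _ 5 ?_).trans ?_
    · intro φ hφ
      rcases List.mem_append.1 hφ with hφ | hφ
      · rcases List.mem_append.1 hφ with hφ | hφ
        · obtain ⟨i, -, rfl⟩ := List.mem_map.1 hφ
          refine (lit_size _ _).trans ?_
          simp [Fml.size]
        · obtain ⟨i, -, rfl⟩ := List.mem_map.1 hφ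
          refine (lit_size _ _).trans ?_
          simp [Fml.size]
      · obtain ⟨i, -, hφ⟩ := List.mem_flatMap.1 hφ
        obtain ⟨k, -, rfl⟩ := List.mem_map.1 hφ
        refine (lit_size _ _).trans ?_
        simp [Fml.size]
    · gcongr
      rw [List.length_append, List.length_append, List.length_map, List.length_map,
        List.length_finRange]
      gcongr
      refine (flatMap_length_le _ _ n ?_).trans ?_
      · intro i _
        rw [List.length_map]
        exact (List.length_filter_le _ _).trans (by simp)
      · simp
  · simp

theorem size_bound (r : Rule) : (nf r).size ≤ 2 ^ (200 * (r.size + 1)) := by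
  have h := rnf_size (mm (encRule r)) (ll (encRule r)) (fun j i => T0 (encRule r) j i)
    (fun j i => T1 (encRule r) j i) (fun j i k => T2 (encRule r) j i k)
  have hm := mm_le r
  have e : (nf r).size = (rnfPremise (mm (encRule r)) (ll (encRule r))
    (fun j i => T0 (encRule r) j i) (fun j i => T1 (encRule r) j i)
    (fun j i k => T2 (encRule r) j i k)).size + 1 := by
    simp only [nf, Rule.size, Fml.size, List.map_cons, List.map_nil, List.sum_cons,
      List.sum_nil, Nat.add_zero]
  rw [e]
  rw [ll] at h
  rw [ll]
  set m := mm (encRule r) with hmdef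
  clear_value m
  have hlt : m < 2 ^ m := Nat.lt_two_pow_self
  have h1 : 1 ≤ 2 ^ m := Nat.one_le_two_pow
  have h2 : (3 + (m + m + m * m) * 10) + 3 ≤ 36 * (2 ^ m * 2 ^ m) := by
    nlinarith [Nat.mul_le_mul hlt.le hlt.le, Nat.mul_le_mul h1 h1, Nat.mul_le_mul hlt.le h1]
  have h3 : 1 ≤ 2 ^ (4 * m) * (2 ^ m * 2 ^ m) :=
    Nat.one_le_iff_ne_zero.2 (by positivity)
  have h4 : 1 + 2 ^ (4 * m) * ((3 + (m + m + m * m) * 10) + 3) + 1 ≤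
      64 * (2 ^ (4 * m) * (2 ^ m * 2 ^ m)) := by
    have := Nat.mul_le_mul_left (2 ^ (4 * m)) h2
    nlinarith
  have h5 : 64 * (2 ^ (4 * m) * (2 ^ m * 2 ^ m)) = 2 ^ (6 + (4 * m + (m + m))) := by
    rw [pow_add, pow_add, pow_add]; norm_num
  have h6 : 2 ^ (6 + (4 * m + (m + m))) ≤ 2 ^ (200 * (r.size + 1)) :=
    Nat.pow_le_pow_right (by omega) (by omega)
  omega

/-! ### Semantics -/

attribute [irreducible] ll mm

theorem sat_bigConj (t V) (l : List Fml) (a : ℕ) :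
    sat t V (bigConj l) a ↔ ∀ φ ∈ l, sat t V φ a := by
  induction l with
  | nil => simp [bigConj, Fml.top, Fml.neg, sat]
  | cons b l ih =>
    simp only [bigConj, Fml.conj, Fml.neg, sat, ih, List.forall_mem_cons]
    tauto

theorem sat_bigDisj (t V) (l : List Fml) (a : ℕ) :
    sat t V (bigDisj l) a ↔ ∃ φ ∈ l, sat t V φ a := by
  induction l with
  | nil => simp [bigDisj, sat]
  | cons b l ih =>
    simp only [bigDisj, Fml.disj, Fml.neg, sat, ih, List.exists_mem_cons_iff]
    generalize (∃ φ ∈ l, sat t V φ a) = P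
    tauto

theorem sat_lit (t V) (b : Bool) (φ : Fml) (a : ℕ) :
    sat t V (lit b φ) a ↔ (b = true ↔ sat t V φ a) := by
  cases b <;> simp [lit, Fml.neg, sat]

theorem sat_rnf (t V) (n l : ℕ) (S0 S1 : ℕ → ℕ → Bool) (S2 : ℕ → ℕ → ℕ → Bool) (a : ℕ) :
    sat t V (rnfPremise n l (fun j i => S0 j i) (fun j i => S1 j i) (fun j i k => S2 j i k)) a ↔
    ∃ j < l, (∀ i < n, (S0 j i = true ↔ a ∈ V i)) ∧ (∀ i < n, (S1 j i = true ↔ a + 1 ∈ V i)) ∧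
      ∀ i < n, ∀ k < n, k ≠ i →
        (S2 j i k = true ↔ sat t V (.untl (.letter i) (.letter k)) a) := by
  rw [rnfPremise, sat_bigDisj]
  constructor
  · rintro ⟨φ, hφ, h⟩
    obtain ⟨j, -, rfl⟩ := List.mem_map.1 hφ
    rw [sat_bigConj] at h
    refine ⟨j, j.2, ?_, ?_, ?_⟩
    · intro i hi
      exact (sat_lit _ _ _ _ _).1 (h _ (List.mem_append_left _ (List.mem_append_left _
        (List.mem_map.2 ⟨⟨i, hi⟩, List.mem_finRange _, rfl⟩))))
    · intro i hi
      exact (sat_lit _ _ _ _ _).1 (h _ (List.mem_append_left _ (List.mem_append_right _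
        (List.mem_map.2 ⟨⟨i, hi⟩, List.mem_finRange _, rfl⟩))))
    · intro i hi k hk hne
      exact (sat_lit _ _ _ _ _).1 (h _ (List.mem_append_right _
        (List.mem_flatMap.2 ⟨⟨i, hi⟩, List.mem_finRange _, List.mem_map.2 ⟨⟨k, hk⟩,
          List.mem_filter.2 ⟨List.mem_finRange _, by simpa using hne⟩, rfl⟩⟩)))
  · rintro ⟨j, hj, h0, h1, h2⟩
    refine ⟨_, List.mem_map.2 ⟨⟨j, hj⟩, List.mem_finRange _, rfl⟩, ?_⟩
    rw [sat_bigConj]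
    intro φ hφ
    rcases List.mem_append.1 hφ with hφ | hφ
    · rcases List.mem_append.1 hφ with hφ | hφ
      · obtain ⟨i, -, rfl⟩ := List.mem_map.1 hφ
        exact (sat_lit _ _ _ _ _).2 (h0 i i.2)
      · obtain ⟨i, -, rfl⟩ := List.mem_map.1 hφ
        exact (sat_lit _ _ _ _ _).2 (h1 i i.2)
    · obtain ⟨i, -, hφ⟩ := List.mem_flatMap.1 hφ
      obtain ⟨k, hk, rfl⟩ := List.mem_map.1 hφ
      have hne : (k : ℕ) ≠ i := by
        have := (List.mem_filter.1 hk).2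
        intro h
        exact (by simpa using this : ¬ k = i) (Fin.ext h)
      exact (sat_lit _ _ _ _ _).2 (h2 i i.2 k k.2 hne)

theorem allB_iff (f : ℕ → Bool) (l : List ℕ) : allB f l = true ↔ ∀ x ∈ l, f x = true := by
  induction l with
  | nil => simp [allB]
  | cons a l ih =>
    simp only [allB, List.foldr_cons, Bool.and_eq_true, List.forall_mem_cons] at ih ⊢
    rw [ih]

theorem good_iff (c j : ℕ) : good c j = true ↔ (∀ k ∈ nodes c, nodeOK c j k = true) ∧
    (∀ k ∈ prems c, vv c j 0 k = true) ∧ (vv c j 0 c.unpair.2 = true → bt j 0 = true) ∧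
    bt j 1 = true := by
  simp only [good, Bool.and_eq_true, allB_iff, Bool.or_eq_true, Bool.not_eq_true']
  cases vv c j 0 c.unpair.2 <;> simp

theorem nodeOK_letter (c j p : ℕ) : nodeOK c j (Nat.pair 0 p) = true := by
  simp only [nodeOK, Nat.unpair_pair]; rfl
theorem nodeOK_bot (c j : ℕ) :
    nodeOK c j (Nat.pair 1 0) = true ↔ ¬ vv c j 0 (Nat.pair 1 0) = true := by
  simp only [nodeOK, Nat.unpair_pair]; simp
theorem nodeOK_imp (c j a b : ℕ) : nodeOK c j (Nat.pair 2 (Nat.pair a b)) = true ↔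
    (vv c j 0 (Nat.pair 2 (Nat.pair a b)) = true ↔ (vv c j 0 a = true → vv c j 0 b = true)) := by
  simp only [nodeOK, Nat.unpair_pair, Nat.reduceBEq, cond_true, cond_false]
  generalize vv c j 0 (Nat.pair 2 (Nat.pair a b)) = x
  generalize vv c j 0 a = y
  generalize vv c j 0 b = z
  revert x y z; decide
theorem nodeOK_next (c j a : ℕ) : nodeOK c j (Nat.pair 3 a) = true ↔
    (vv c j 0 (Nat.pair 3 a) = true ↔ vv c j (mm c) a = true) := by
  simp only [nodeOK, Nat.unpair_pair, Nat.reduceBEq, cond_true, cond_false]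
  generalize vv c j 0 (Nat.pair 3 a) = x
  generalize vv c j (mm c) a = y
  revert x y; decide
theorem nodeOK_untl (c j a b : ℕ) : nodeOK c j (Nat.pair 4 (Nat.pair a b)) = true ↔
    (vv c j 0 (Nat.pair 4 (Nat.pair a b)) = true ↔ (vv c j 0 b = true ∨ (vv c j 0 a = true ∧
      vv c j (3 * mm c) (Nat.pair 2 (Nat.pair a b)) = true ∧
      vv c j (mm c) (Nat.pair 4 (Nat.pair a b)) = true))) := by
  simp only [nodeOK, Nat.unpair_pair, Nat.reduceBEq, cond_true, cond_false]
  generalize vv c j 0 (Nat.pair 4 (Nat.pair a b)) = x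
  generalize vv c j 0 a = y
  generalize vv c j 0 b = z
  generalize vv c j (3 * mm c) (Nat.pair 2 (Nat.pair a b)) = u
  generalize vv c j (mm c) (Nat.pair 4 (Nat.pair a b)) = v
  revert x y z u v; decide

/-- truth of node `k` at `a` in a model of the normal form -/
def val (c : ℕ) (V : ℕ → Set ℕ) (k a : ℕ) : Prop :=
  a ∈ V (2 * (nodes c).idxOf k + 2) ∨ a ∈ V (2 * (nodes c).idxOf k + 3)

theorem idx_lt (c k : ℕ) (hk : k ∈ nodes c) : 2 * (nodes c).idxOf k + 3 < mm c := by
  have := List.idxOf_lt_length_of_mem hk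
  rw [mm]; omega

/-- The bits of `j` describe the point `a` of the model `V`. -/
structure Desc (c j : ℕ) (t : ℕ → ℕ) (V : ℕ → Set ℕ) (a : ℕ) : Prop where
  b0 : ∀ i < mm c, (bt j i = true ↔ a ∈ V i)
  b1 : ∀ i < mm c, (bt j (mm c + i) = true ↔ a + 1 ∈ V i)
  b3 : ∀ i < mm c, 1 ≠ i → (bt j (3 * mm c + i) = true ↔ ∃ b, a ≤ b ∧ b ≤ t a ∧ b ∈ V i)

theorem Desc.v0 {c j t V a} (h : Desc c j t V a) (k : ℕ) (hk : k ∈ nodes c) :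
    vv c j 0 k = true ↔ val c V k a := by
  have := idx_lt c k hk
  rw [vv, Bool.or_eq_true, Nat.zero_add, Nat.zero_add, h.b0 _ (by omega), h.b0 _ (by omega), val]

theorem Desc.v1 {c j t V a} (h : Desc c j t V a) (k : ℕ) (hk : k ∈ nodes c) :
    vv c j (mm c) k = true ↔ val c V k (a + 1) := by
  have := idx_lt c k hk
  rw [vv, Bool.or_eq_true, h.b1 _ (by omega), h.b1 _ (by omega), val]

theorem Desc.v3 {c j t V a} (h : Desc c j t V a) (k : ℕ) (hk : k ∈ nodes c) :
    vv c j (3 * mm c) k = true ↔ ∃ b, a ≤ b ∧ b ≤ t a ∧ val c V k b := by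
  have := idx_lt c k hk
  rw [vv, Bool.or_eq_true, h.b3 _ (by omega) (by omega), h.b3 _ (by omega) (by omega)]
  simp only [val]
  constructor
  · rintro (⟨b, h1, h2, h3⟩ | ⟨b, h1, h2, h3⟩)
    · exact ⟨b, h1, h2, Or.inl h3⟩
    · exact ⟨b, h1, h2, Or.inr h3⟩
  · rintro ⟨b, h1, h2, h3 | h3⟩
    · exact Or.inl ⟨b, h1, h2, h3⟩
    · exact Or.inr ⟨b, h1, h2, h3⟩

/-- bounded until -/
def Unt (t : ℕ → ℕ) (A B : ℕ → Prop) (a : ℕ) : Prop :=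
  ∃ b, a ≤ b ∧ b ≤ t a ∧ B b ∧ ∀ c, a ≤ c → c < b → A c

theorem unt_rec (t : ℕ → ℕ) (ht : NTFrame t) (A B : ℕ → Prop) (a : ℕ) :
    Unt t A B a ↔ (B a ∨ (A a ∧ (∃ b, a ≤ b ∧ b ≤ t a ∧ (A b → B b)) ∧ Unt t A B (a + 1))) := by
  have h1 := ht.1 a
  have h2 := ht.2 a
  constructor
  · rintro ⟨b, hab, hbt, hB, hA⟩
    rcases Nat.eq_or_lt_of_le hab with rfl | hlt
    · exact Or.inl hB
    · exact Or.inr ⟨hA a le_rfl hlt, ⟨b, hab, hbt, fun _ => hB⟩, b, hlt, by omega, hB,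
        fun c hc => hA c (by omega)⟩
  · rintro (hB | ⟨hA, ⟨b, hab, hbt, hE⟩, b', hab', -, hB', hA'⟩)
    · exact ⟨a, le_rfl, h1.le, hB, fun c _ _ => by omega⟩
    · have hAll : ∀ c, a ≤ c → c < b' → A c := by
        intro c hc hcb
        rcases Nat.eq_or_lt_of_le hc with rfl | hlt
        · exact hA
        · exact hA' c hlt hcb
      by_cases hbb : b < b'
      · exact ⟨b, hab, hbt, hE (hAll b hab hbb), fun c hc hcb => hAll c hc (by omega)⟩
      · exact ⟨b', by omega, by omega, hB', hAll⟩

theorem unt_unique (t : ℕ → ℕ) (ht : NTFrame t) (A B U : ℕ → Prop)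
    (hU : ∀ a, U a ↔ (B a ∨ (A a ∧ (∃ b, a ≤ b ∧ b ≤ t a ∧ (A b → B b)) ∧ U (a + 1)))) (a : ℕ) :
    U a ↔ Unt t A B a := by
  have key : ∀ n a, a + n ≤ t a → (A (a + n) → B (a + n)) → U a → Unt t A B a := by
    intro n
    induction n with
    | zero =>
      intro a h1 h2 hu
      rw [unt_rec t ht]
      rcases (hU a).1 hu with h | ⟨h, -⟩
      · exact Or.inl h
      · exact Or.inl (h2 h)
    | succ n ih =>
      intro a h1 h2 hu
      rw [unt_rec t ht]
      have h3 := ht.2 a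
      rcases (hU a).1 hu with h | ⟨h, hD, hu'⟩
      · exact Or.inl h
      · refine Or.inr ⟨h, hD, ih (a + 1) (by omega) ?_ hu'⟩
        rwa [Nat.add_right_comm, Nat.add_assoc]
  constructor
  · intro hu
    rcases (hU a).1 hu with h | ⟨h, ⟨b, hab, hbt, hE⟩, hu'⟩
    · rw [unt_rec t ht]; exact Or.inl h
    · obtain ⟨n, rfl⟩ := Nat.exists_eq_add_of_le hab
      exact key n a hbt hE hu
  · rintro ⟨b, hab, hbt, hB, hA⟩
    obtain ⟨n, rfl⟩ := Nat.exists_eq_add_of_le hab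
    clear hab
    induction n generalizing a with
    | zero => exact (hU a).2 (Or.inl hB)
    | succ n ih =>
      have h3 := ht.2 a
      refine (hU a).2 (Or.inr ⟨hA a le_rfl (by omega), ⟨_, by omega, hbt, fun _ => hB⟩, ?_⟩)
      refine ih (a + 1) (by omega) ?_ fun c h1 h2 => hA c (by omega) (by omega)
      rwa [Nat.add_right_comm, Nat.add_assoc]

theorem Desc.imp_ok {c j t V a} (h : Desc c j t V a) {x y : ℕ}
    (hk : sub (Nat.pair 2 (Nat.pair x y)) ⊆ nodes c) :
    nodeOK c j (Nat.pair 2 (Nat.pair x y)) = true ↔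
      (val c V (Nat.pair 2 (Nat.pair x y)) a ↔ (val c V x a → val c V y a)) := by
  rw [sub_imp] at hk
  have hx : x ∈ nodes c := hk (by simp [mem_sub_self])
  have hy : y ∈ nodes c := hk (by simp [mem_sub_self])
  have h0 : Nat.pair 2 (Nat.pair x y) ∈ nodes c := hk (by simp)
  rw [nodeOK_imp, h.v0 _ hx, h.v0 _ hy, h.v0 _ h0]

theorem Desc.bot_ok {c j t V a} (h : Desc c j t V a)
    (hk : sub (Nat.pair 1 0) ⊆ nodes c) :
    nodeOK c j (Nat.pair 1 0) = true ↔ ¬ val c V (Nat.pair 1 0) a := by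
  rw [nodeOK_bot, h.v0 _ (hk (mem_sub_self _))]

theorem Desc.next_ok {c j t V a} (h : Desc c j t V a) {x : ℕ}
    (hk : sub (Nat.pair 3 x) ⊆ nodes c) :
    nodeOK c j (Nat.pair 3 x) = true ↔ (val c V (Nat.pair 3 x) a ↔ val c V x (a + 1)) := by
  rw [sub_next] at hk
  have hx : x ∈ nodes c := hk (by simp [mem_sub_self])
  have h0 : Nat.pair 3 x ∈ nodes c := hk (by simp)
  rw [nodeOK_next, h.v1 _ hx, h.v0 _ h0]

theorem Desc.untl_ok {c j t V a} (h : Desc c j t V a) {x y : ℕ}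
    (hk : sub (Nat.pair 4 (Nat.pair x y)) ⊆ nodes c) :
    nodeOK c j (Nat.pair 4 (Nat.pair x y)) = true ↔
      (val c V (Nat.pair 4 (Nat.pair x y)) a ↔ (val c V y a ∨ (val c V x a ∧
        (∃ b, a ≤ b ∧ b ≤ t a ∧ val c V (Nat.pair 2 (Nat.pair x y)) b) ∧
        val c V (Nat.pair 4 (Nat.pair x y)) (a + 1)))) := by
  rw [sub_untl] at hk
  have hx : x ∈ nodes c := hk (by simp [mem_sub_self])
  have hy : y ∈ nodes c := hk (by simp [mem_sub_self])
  have hE : Nat.pair 2 (Nat.pair x y) ∈ nodes c := hk (by simp)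
  have h0 : Nat.pair 4 (Nat.pair x y) ∈ nodes c := hk (by simp)
  rw [nodeOK_untl, h.v0 _ hx, h.v0 _ hy, h.v0 _ h0, h.v1 _ h0, h.v3 _ hE]

theorem sub_untl_imp (c x y : ℕ) (hk : sub (Nat.pair 4 (Nat.pair x y)) ⊆ nodes c) :
    sub (Nat.pair 2 (Nat.pair x y)) ⊆ nodes c := by
  rw [sub_untl] at hk
  rw [sub_imp]
  exact fun z hz => hk (List.mem_cons_of_mem _ hz)

/-- If all points satisfy the local constraints, then `val` is truth. -/
theorem truth (c : ℕ) (t : ℕ → ℕ) (ht : NTFrame t) (V : ℕ → Set ℕ)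
    (H : ∀ a, ∃ j, Desc c j t V a ∧ ∀ k ∈ nodes c, nodeOK c j k = true) (φ : Fml) :
    sub (encF φ) ⊆ nodes c →
    ∀ a, sat t (fun p => {a | val c V (Nat.pair 0 p) a}) φ a ↔ val c V (encF φ) a := by
  induction φ with
  | letter p => intro _ a; rfl
  | bot =>
    intro hs a
    obtain ⟨j, hd, hn⟩ := H a
    have := (hd.bot_ok hs).1 (hn _ (hs (mem_sub_self _)))
    simpa [sat, encF] using this
  | imp x y ihx ihy =>
    intro hs a
    obtain ⟨j, hd, hn⟩ := H a
    have := (hd.imp_ok hs).1 (hn _ (hs (mem_sub_self _)))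
    rw [encF, sub_imp] at hs
    rw [encF, this, sat, ihx (fun z hz => hs (by simp [hz])), ihy (fun z hz => hs (by simp [hz]))]
  | next x ihx =>
    intro hs a
    obtain ⟨j, hd, hn⟩ := H a
    have := (hd.next_ok hs).1 (hn _ (hs (mem_sub_self _)))
    rw [encF, sub_next] at hs
    rw [encF, this, sat, ihx (fun z hz => hs (by simp [hz]))]
  | untl x y ihx ihy =>
    intro hs a
    have hs' := sub_untl_imp c _ _ hs
    have hE : ∀ a, val c V (Nat.pair 2 (Nat.pair (encF x) (encF y))) a ↔
        (val c V (encF x) a → val c V (encF y) a) := by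
      intro a
      obtain ⟨j, hd, hn⟩ := H a
      exact (hd.imp_ok hs').1 (hn _ (hs' (mem_sub_self _)))
    have hU := unt_unique t ht (val c V (encF x)) (val c V (encF y))
      (val c V (encF (.untl x y))) (by
        intro a
        obtain ⟨j, hd, hn⟩ := H a
        have := (hd.untl_ok hs).1 (hn _ (hs (mem_sub_self _)))
        simp only [hE] at this
        exact this) a
    rw [hU]
    rw [encF, sub_untl] at hs
    simp only [sat, Unt, ihx (fun z hz => hs (by simp [hz])), ihy (fun z hz => hs (by simp [hz]))]

theorem two_le_mm (c : ℕ) : 2 ≤ mm c := by rw [mm]; omega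

theorem point_desc (c : ℕ) (t : ℕ → ℕ) (V : ℕ → Set ℕ) (a : ℕ)
    (h : sat t V (rnfPremise (mm c) (ll c) (fun j i => T0 c j i)
      (fun j i => T1 c j i) (fun j i k => T2 c j i k)) a) :
    ∃ j, good c j = true ∧ (∀ i < mm c, (bt j i = true ↔ a ∈ V i)) ∧
      (∀ i < mm c, (bt j (mm c + i) = true ↔ a + 1 ∈ V i)) ∧
      (∀ k < mm c, k ≠ 1 →
        (bt j (3 * mm c + k) = true ↔ sat t V (.untl (.letter 1) (.letter k)) a)) := by
  have hm := two_le_mm c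
  rw [sat_rnf t V (mm c) (ll c) (T0 c) (T1 c) (T2 c)] at h
  obtain ⟨j, -, h0, h1, h2⟩ := h
  have hg : good c j = true := by
    by_contra hg
    rw [Bool.not_eq_true] at hg
    have e0 := h0 0 (by omega)
    have e1 := h0 1 (by omega)
    have e2 := h2 0 (by omega) 1 (by omega) (by omega)
    simp only [T0, T2, hg, Bool.false_and, Bool.not_false, Bool.true_or, true_iff,
      Bool.false_eq_true, false_iff] at e0 e1 e2
    obtain ⟨b, hab, -, hb, hA⟩ := e2
    rcases Nat.eq_or_lt_of_le hab with rfl | hlt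
    · exact e1 hb
    · exact e0 (hA a le_rfl hlt)
  refine ⟨j, hg, ?_, ?_, ?_⟩
  · intro i hi
    have := h0 i hi
    rwa [T0, hg, Bool.true_and] at this
  · intro i hi
    exact h1 i hi
  · intro k hk hne
    have := h2 1 (by omega) k hk hne
    simp only [T2, hg] at this
    simpa using this

theorem valid_nf_of_valid (r : Rule) (t : ℕ → ℕ) (ht : NTFrame t) (hv : validInFrame t r) :
    validInFrame t (nf r) := by
  intro V hprem
  set c := encRule r with hc
  have hm := two_le_mm c
  have hprem' : ∀ a, sat t V (rnfPremise (mm c) (ll c) (fun j i => T0 c j i)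
      (fun j i => T1 c j i) (fun j i k => T2 c j i k)) a :=
    hprem _ List.mem_cons_self
  have hp := fun a => point_desc c t V a (hprem' a)
  have htop : ∀ a, a ∈ V 1 := by
    intro a
    obtain ⟨j, hg, h0, -⟩ := hp a
    exact (h0 1 (by omega)).1 ((good_iff c j).1 hg).2.2.2
  have hD : ∀ a, ∃ j, Desc c j t V a ∧ good c j = true := by
    intro a
    obtain ⟨j, hg, h0, h1, h3⟩ := hp a
    refine ⟨j, ⟨h0, h1, fun i hi hne => ?_⟩, hg⟩
    rw [h3 i hi hne.symm]
    simp [sat, htop]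
  have hT := truth c t ht V (fun a => by
    obtain ⟨j, h1, h2⟩ := hD a
    exact ⟨j, h1, ((good_iff c j).1 h2).1⟩)
  have hc1 := hv (fun p => {a | val c V (Nat.pair 0 p) a}) (by
    intro φ hφ a
    rw [hT φ (prem_sub r φ hφ)]
    obtain ⟨j, h1, h2⟩ := hD a
    rw [← h1.v0 _ (prem_sub r φ hφ (mem_sub_self _))]
    refine ((good_iff c j).1 h2).2.1 _ ?_
    rw [hc, prems_enc]
    exact List.mem_map.2 ⟨φ, hφ, rfl⟩)
  intro a
  have h := hc1 a
  rw [hT _ (concl_sub r)] at h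
  obtain ⟨j, h1, h2⟩ := hD a
  rw [← h1.v0 _ (concl_sub r (mem_sub_self _))] at h
  have h3 := ((good_iff c j).1 h2).2.2.1
  rw [hc, concl_enc] at h3
  have h4 : a ∈ V 0 := (h1.b0 0 (by omega)).1 (h3 h)
  exact h4

/-! ### The other direction -/

theorem bt_eq (j i : ℕ) : bt j i = j.testBit i := by
  rw [bt, Nat.testBit_eq_decide_div_mod_eq]; rfl

open Classical in
theorem exists_bits (m : ℕ) (p0 p1 p2 p3 : ℕ → Prop) : ∃ j < 2 ^ (4 * m), ∀ i < m,
    (bt j i = true ↔ p0 i) ∧ (bt j (m + i) = true ↔ p1 i) ∧ (bt j (2 * m + i) = true ↔ p2 i) ∧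
    (bt j (3 * m + i) = true ↔ p3 i) := by
  let f : Fin (4 * m) → Bool := fun x =>
    if x.1 < m then decide (p0 x) else if x.1 < 2 * m then decide (p1 (x - m)) else
    if x.1 < 3 * m then decide (p2 (x - 2 * m)) else decide (p3 (x - 3 * m))
  refine ⟨Nat.ofBits f, Nat.ofBits_lt_two_pow f, fun i hi => ⟨?_, ?_, ?_, ?_⟩⟩
  · rw [bt_eq, Nat.testBit_ofBits_lt f _ (by omega)]
    simp [f, hi]
  · rw [bt_eq, Nat.testBit_ofBits_lt f _ (by omega)]
    simp only [f]
    rw [if_neg (by omega), if_pos (by omega)]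
    simp
  · rw [bt_eq, Nat.testBit_ofBits_lt f _ (by omega)]
    simp only [f]
    rw [if_neg (by omega), if_neg (by omega), if_pos (by omega)]
    simp
  · rw [bt_eq, Nat.testBit_ofBits_lt f _ (by omega)]
    simp only [f]
    rw [if_neg (by omega), if_neg (by omega), if_neg (by omega)]
    simp

def satC (t : ℕ → ℕ) (V : ℕ → Set ℕ) (k a : ℕ) : Prop := ∃ φ, encF φ = k ∧ sat t V φ a

theorem satC_enc (t V) (φ : Fml) (a : ℕ) : satC t V (encF φ) a ↔ sat t V φ a := by
  constructor
  · rintro ⟨ψ, h, hs⟩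
    rwa [← encF_inj _ _ h]
  · exact fun h => ⟨φ, rfl, h⟩

def newV (c : ℕ) (t : ℕ → ℕ) (V : ℕ → Set ℕ) (p : ℕ) : Set ℕ :=
  if p = 0 then {a | satC t V c.unpair.2 a} else if p = 1 then Set.univ else
    {a | a % 2 = p % 2 ∧ satC t V ((nodes c).getD ((p - 2) / 2) 0) a}

theorem val_newV (c : ℕ) (t V) (k : ℕ) (hk : k ∈ nodes c) (a : ℕ) :
    val c (newV c t V) k a ↔ satC t V k a := by
  have hl := List.idxOf_lt_length_of_mem hk
  have e : (nodes c).getD ((nodes c).idxOf k) 0 = k := by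
    rw [List.getD_eq_getElem _ _ hl]
    exact List.getElem_idxOf hl
  rw [val]
  set i := (nodes c).idxOf k
  have e1 : (2 * i + 2 - 2) / 2 = i := by omega
  have e2 : (2 * i + 3 - 2) / 2 = i := by omega
  have e3 : (2 * i + 2) % 2 = 0 := by omega
  have e4 : (2 * i + 3) % 2 = 1 := by omega
  rw [newV, newV, if_neg (by omega), if_neg (by omega), if_neg (by omega), if_neg (by omega),
    e1, e2, e3, e4, e]
  simp only [Set.mem_ofPred_eq]
  have := Nat.mod_two_eq_zero_or_one a
  tauto

theorem newV_alt (c : ℕ) (t V) (i : ℕ) (hi : 2 ≤ i) (a : ℕ) (h : a ∈ newV c t V i) :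
    a + 1 ∉ newV c t V i := by
  rw [newV, if_neg (by omega), if_neg (by omega)] at h ⊢
  intro h'
  have h1 := h.1
  have h2 := h'.1
  omega

theorem valid_of_valid_nf (r : Rule) (t : ℕ → ℕ) (ht : NTFrame t) (hv : validInFrame t (nf r)) :
    validInFrame t r := by
  intro V hprem
  set c := encRule r with hc
  have hm := two_le_mm c
  set W := newV c t V with hW
  have hval : ∀ k ∈ nodes c, ∀ a, val c W k a ↔ satC t V k a := fun k hk a =>
    val_newV c t V k hk a
  have htop : ∀ a, a ∈ W 1 := by intro a; simp [hW, newV]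
  have hx0 : ∀ a, a ∈ W 0 ↔ sat t V r.concl a := by
    intro a
    rw [hW, newV, if_pos rfl, hc, concl_enc]
    exact satC_enc _ _ _ _
  have := hv W (by
    intro φ hφ a
    rw [List.mem_singleton.1 hφ]
    rw [sat_rnf t W (mm c) (ll c) (T0 c) (T1 c) (T2 c)]
    obtain ⟨j, hj, hb⟩ := exists_bits (mm c) (fun i => a ∈ W i) (fun i => a + 1 ∈ W i)
      (fun i => sat t W (.untl (.letter 0) (.letter i)) a)
      (fun i => sat t W (.untl (.letter 1) (.letter i)) a)
    have hd : Desc c j t W a := by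
      refine ⟨fun i hi => (hb i hi).1, fun i hi => (hb i hi).2.1, fun i hi _ => ?_⟩
      rw [(hb i hi).2.2.2]
      simp [sat, htop]
    have hg : good c j = true := by
      rw [good_iff]
      refine ⟨?_, ?_, ?_, ?_⟩
      · intro k hk
        obtain ⟨ψ, rfl, hs⟩ := nodes_closed r k hk
        cases ψ with
        | letter p => exact nodeOK_letter _ _ _
        | bot =>
          refine (hd.bot_ok hs).2 ?_
          rw [hval (Nat.pair 1 0) hk]
          exact fun h => (satC_enc t V .bot a).1 h
        | imp x y =>
          refine (hd.imp_ok hs).2 ?_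
          rw [encF, sub_imp] at hs
          rw [hval _ (hs (by simp)), hval _ (hs (by simp [mem_sub_self])),
            hval _ (hs (by simp [mem_sub_self])), satC_enc, satC_enc]
          exact satC_enc t V (.imp x y) a
        | next x =>
          refine (hd.next_ok hs).2 ?_
          rw [encF, sub_next] at hs
          rw [hval _ (hs (by simp)), hval _ (hs (by simp [mem_sub_self])), satC_enc]
          exact satC_enc t V (.next x) a
        | untl x y =>
          refine (hd.untl_ok hs).2 ?_
          rw [encF, sub_untl] at hs
          have eU : ∀ a, satC t V (Nat.pair 4 (Nat.pair (encF x) (encF y))) a ↔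
              Unt t (sat t V x) (sat t V y) a := satC_enc t V (.untl x y)
          have eE : ∀ a, satC t V (Nat.pair 2 (Nat.pair (encF x) (encF y))) a ↔
              (sat t V x a → sat t V y a) := satC_enc t V (.imp x y)
          have hE : Nat.pair 2 (Nat.pair (encF x) (encF y)) ∈ nodes c := hs (by simp)
          simp only [hval _ hE, eE]
          rw [hval _ (hs (by simp)), hval _ (hs (by simp [mem_sub_self])),
            hval _ (hs (by simp [mem_sub_self])), hval _ (hs (by simp)), satC_enc, satC_enc,
            eU, eU]
          exact unt_rec t ht _ _ a
      · intro k hk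
        rw [hc, prems_enc] at hk
        obtain ⟨φ, hφ, rfl⟩ := List.mem_map.1 hk
        have hn := prem_sub r φ hφ (mem_sub_self _)
        rw [hd.v0 _ hn, hval _ hn, satC_enc]
        exact hprem φ hφ a
      · have hn := concl_sub r (mem_sub_self _)
        rw [hc, concl_enc, ← hc, hd.v0 _ hn, hval _ hn, satC_enc, hd.b0 0 (by omega), hx0]
        exact id
      · exact (hd.b0 1 (by omega)).2 (htop a)
    refine ⟨j, by rw [ll]; exact hj, ?_, ?_, ?_⟩
    · intro i hi
      rw [T0, hg, Bool.true_and, hd.b0 i hi]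
    · exact hd.b1
    · intro i hi k hk hne
      rw [T2, hg, Bool.not_true, Bool.false_or]
      by_cases h2 : i < 2
      · rw [decide_eq_true h2, cond_true]
        have h01 : i = 0 ∨ i = 1 := by omega
        rcases h01 with rfl | rfl
        · exact (hb k hk).2.2.1
        · exact (hb k hk).2.2.2
      · rw [decide_eq_false h2, cond_false, Bool.or_eq_true, Bool.and_eq_true, hd.b0 k hk,
          hd.b0 i hi, hd.b1 k hk]
        simp only [sat]
        have h1 := ht.1 a
        constructor
        · rintro (h | ⟨h, h'⟩)
          · exact ⟨a, le_rfl, h1.le, h, fun c _ _ => by omega⟩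
          · refine ⟨a + 1, by omega, h1, h', fun c hc1 hc2 => ?_⟩
            have : c = a := by omega
            rw [this]; exact h
        · rintro ⟨b, hab, hbt, hB, hA⟩
          rcases Nat.eq_or_lt_of_le hab with rfl | hlt
          · exact Or.inl hB
          · have ha := hA a le_rfl hlt
            rcases Nat.eq_or_lt_of_le hlt with rfl | hlt'
            · exact Or.inr ⟨ha, hB⟩
            · exact absurd (hA (a + 1) (by omega) hlt')
                (newV_alt c t V i (by omega) a ha))
  intro a
  exact (hx0 a).1 (this a)

theorem isRNF_nf (r : Rule) : ∃ n l, IsRNF n l (nf r) := by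
  refine ⟨mm (encRule r), ll (encRule r), ?_, ?_, rfl, _, _, _, rfl⟩
  · have := two_le_mm (encRule r); omega
  · rw [ll]; positivity

end RNF

/-- every rule has a reduced normal form, computable from the rule,
of at most single-exponential size, valid in exactly the same non-transitive
linear frames. -/
theorem stmt1 :
    ∃ nf : Rule → Rule,
      (∃ F : ℕ → ℕ, Computable F ∧ ∀ r : Rule, F (encRule r) = encRule (nf r)) ∧
      (∃ C : ℕ, ∀ r : Rule, (nf r).size ≤ 2 ^ (C * (r.size + 1))) ∧
      (∀ r : Rule, ∃ n l, IsRNF n l (nf r)) ∧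
      (∀ r : Rule, ∀ t, NTFrame t → (validInFrame t r ↔ validInFrame t (nf r))) := by
  exact ⟨RNF.nf, ⟨RNF.FF, RNF.FF_pr.to_comp, RNF.FF_spec⟩, ⟨200, RNF.size_bound⟩, RNF.isRNF_nf,
    fun r t ht => ⟨RNF.valid_nf_of_valid r t ht, RNF.valid_of_valid_nf r t ht⟩⟩
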